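/- arXiv:1710.10825 — 6 statements merged into one kernel-verified Lean document; each statement's English description precedes it below -/
import Mathlib

section
/- Suppose α is a type in universe u+1 carrying a partial order together with a bijection e : α ≃ Ordinal.{u}, and suppose α contains an antichain A₀ that is not u-small. Then there exists an antichain A ⊆ A₀ such that for every u-small subset B of α it is NOT the case that sup A = sup B in the generalized sense; in particular, no element p of α is a supremum of A in the predensity sense, i.e. A has no supremum. (Rendering of Lemma 4.4 of the paper: a class partial order with a proper-class-sized antichain has an antichain whose supremum does not equal the supremum of any set-sized collection of conditions.) -/
universe u

/-- Two conditions are compatible if they have a common extension. -/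
def Compatible {P : Type*} [PartialOrder P] (p q : P) : Prop :=
  ∃ r, r ≤ p ∧ r ≤ q

/-- A set of conditions is an antichain if distinct elements are incompatible. -/
def IsAntichain' {P : Type*} [PartialOrder P] (A : Set P) : Prop :=
  ∀ p ∈ A, ∀ q ∈ A, p ≠ q → ¬ Compatible p q

/-- A set `D` is predense below `p` if every `q ≤ p` is compatible with some element of `D`. -/
def PredenseBelow {P : Type*} [PartialOrder P] (D : Set P) (p : P) : Prop :=
  ∀ q ≤ p, ∃ d ∈ D, Compatible q d

/-- `sup A = sup B` in the generalized sense: `A` is predense below every element of `B`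
and `B` is predense below every element of `A`. -/
def SupEq {P : Type*} [PartialOrder P] (A B : Set P) : Prop :=
  (∀ b ∈ B, PredenseBelow A b) ∧ (∀ a ∈ A, PredenseBelow B a)

/-- `p` is a supremum of `A` in the predensity sense: `p` bounds `A` from above and
`A` is predense below `p`. -/
def IsSupPredense {P : Type*} [PartialOrder P] (A : Set P) (p : P) : Prop :=
  (∀ a ∈ A, a ≤ p) ∧ PredenseBelow A p

theorem Compatible.mono_left {P : Type*} [PartialOrder P] {p q r : P} (h : p ≤ q)
    (hp : Compatible p r) : Compatible q r :=
  let ⟨s, hs, hr⟩ := hp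
  ⟨s, hs.trans h, hr⟩

/-- A supremum of `A` in the predensity sense has the same generalized supremum as `A`. -/
theorem IsSupPredense.supEq_singleton {P : Type*} [PartialOrder P] {A : Set P} {p : P}
    (h : IsSupPredense A p) : SupEq A {p} := by
  refine ⟨?_, fun a ha q hq => ⟨p, rfl, q, le_rfl, hq.trans (h.1 a ha)⟩⟩
  rintro b rfl
  exact h.2

theorem IsAntichain'.subset {P : Type*} [PartialOrder P] {A A' : Set P}
    (hA : IsAntichain' A) (h : A' ⊆ A) : IsAntichain' A' :=
  fun p hp q hq => hA p (h hp) q (h hq)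

/-- Subsets of an antichain are ordered by inclusion as soon as their generalized suprema agree
with that of a common set. -/
theorem IsAntichain'.subset_of_supEq {P : Type*} [PartialOrder P] {A₀ A A' B : Set P}
    (h₀ : IsAntichain' A₀) (hA : A ⊆ A₀) (hA' : A' ⊆ A₀) (h : SupEq A B) (h' : SupEq A' B) :
    A ⊆ A' := by
  intro a ha
  obtain ⟨b, hb, r, hra, hrb⟩ := h.2 a ha a le_rfl
  obtain ⟨a', ha', hc⟩ := h'.1 b hb r hrb
  by_contra hn
  exact h₀ a (hA ha) a' (hA' ha') (fun hEq => hn (hEq ▸ ha')) (hc.mono_left hra)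

/-- There are at most `univ` many bounded sets of ordinals. -/
theorem mk_sigma_set_Iio_le_univ :
    Cardinal.mk (Σ β : Ordinal.{u}, Set (Set.Iio β)) ≤ Cardinal.univ.{u, u + 1} := by
  have hcard (β : Ordinal.{u}) :
      Cardinal.mk (Set (Set.Iio β)) ≤ Cardinal.univ.{u, u + 1} := by
    have := (Cardinal.small_iff_lift_mk_lt_univ (α := Set (Set.Iio β))).1 inferInstance
    simpa using this.le
  have hinf : Cardinal.aleph0 ≤ Cardinal.univ.{u, u + 1} := Cardinal.aleph0_lt_univ.le
  have hord : Cardinal.mk Ordinal.{u} = Cardinal.univ.{u, u + 1} := Cardinal.mk_ordinal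
  rw [Cardinal.mk_sigma]
  calc _ ≤ Cardinal.sum fun _ : Ordinal.{u} => Cardinal.univ.{u, u + 1} :=
        Cardinal.sum_le_sum _ _ hcard
    _ = Cardinal.univ.{u, u + 1} := by
        rw [Cardinal.sum_const', hord, Cardinal.mul_eq_self hinf]

theorem exists_Iio_image_eq_of_small (B : Set Ordinal.{u}) [Small.{u} B] :
    ∃ s : Σ β : Ordinal.{u}, Set (Set.Iio β), Subtype.val '' s.2 = B := by
  obtain ⟨β, hβ⟩ := Ordinal.bddAbove_of_small (s := B)
  refine ⟨⟨Order.succ β, Subtype.val ⁻¹' B⟩, ?_⟩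
  rw [Subtype.image_preimage_coe, Set.inter_eq_right]
  exact fun b hb => Order.lt_succ_of_le (hβ hb)

/-- A class partial order with a proper-class-sized antichain contains an antichain whose
generalized supremum does not equal the generalized supremum of any set-sized collection
of conditions; in particular, this antichain has no supremum in the predensity sense. -/
theorem antichain_no_small_supEq (α : Type (u + 1)) [PartialOrder α]
    (e : α ≃ Ordinal.{u}) (A₀ : Set α) (hA₀ : IsAntichain' A₀)
    (hbig : ¬ Small.{u} A₀) :
    ∃ A ⊆ A₀, IsAntichain' A ∧ (∀ B : Set α, Small.{u} B → ¬ SupEq A B) ∧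
      ∀ p : α, ¬ IsSupPredense A p := by
  suffices H : ∃ A ⊆ A₀, ∀ B : Set α, Small.{u} B → ¬ SupEq A B by
    obtain ⟨A, hA, hB⟩ := H
    exact ⟨A, hA, hA₀.subset hA, hB, fun p hp => hB {p} inferInstance hp.supEq_singleton⟩
  by_contra! H
  have hcode (X : Set A₀) : ∃ s : Σ β : Ordinal.{u}, Set (Set.Iio β),
      SupEq (Subtype.val '' X) (e.symm '' (Subtype.val '' s.2)) := by
    obtain ⟨B, hB, hXB⟩ := H (Subtype.val '' X) (Subtype.coe_image_subset _ _)
    obtain ⟨s, hs⟩ := exists_Iio_image_eq_of_small (e '' B)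
    refine ⟨s, ?_⟩
    rwa [hs, e.symm_image_image]
  choose g hg using hcode
  have hinj : Function.Injective g := fun X Y hXY => by
    have hX := hg X
    rw [hXY] at hX
    apply Set.image_injective.2 Subtype.val_injective
    have hsub (Z : Set A₀) : Subtype.val '' Z ⊆ A₀ := Subtype.coe_image_subset _ _
    exact (hA₀.subset_of_supEq (hsub X) (hsub Y) hX (hg Y)).antisymm
      (hA₀.subset_of_supEq (hsub Y) (hsub X) (hg Y) hX)
  have huniv : Cardinal.univ.{u, u + 1} ≤ Cardinal.mk A₀ := by
    rw [Cardinal.small_iff_lift_mk_lt_univ, not_lt] at hbig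
    simpa using hbig
  have hlt : Cardinal.mk A₀ < Cardinal.mk (Set A₀) := by
    rw [Cardinal.mk_set]
    exact Cardinal.cantor _
  exact (hlt.trans_le ((Cardinal.mk_le_of_injective hinj).trans
    mk_sigma_set_Iio_le_univ)).not_ge huniv
end

section
/- Let α be a type in universe u+1 carrying a Boolean algebra structure together with a bijection e : α ≃ Ordinal.{u} (a class-sized Boolean algebra), and suppose α is 𝒞-complete, i.e. every subset S : Set α has a least upper bound in α. Then α satisfies the Ord-chain condition: every set A ⊆ α with ⊥ ∉ A whose elements are pairwise disjoint (x ⊓ y = ⊥ for all distinct x, y ∈ A) is u-small. (This is the implication from the existence of a Boolean 𝒞-completion to the Ord-cc in the theorem of Section 4 of the paper: a 𝒞-complete class-sized Boolean algebra cannot contain a proper-class-sized antichain.) -/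
universe u

/-- Suprema of subsets of an antichain in a Boolean algebra determine the subsets: a set is
contained in any other whose supremum dominates its own. -/
theorem subset_of_isLUB_le_of_antichain {α : Type*} [BooleanAlgebra α] {A S T : Set α}
    (hbot : ⊥ ∉ A) (hdisj : ∀ x ∈ A, ∀ y ∈ A, x ≠ y → x ⊓ y = ⊥) (hSA : S ⊆ A) (hTA : T ⊆ A)
    {p q : α} (hp : IsLUB S p) (hq : IsLUB T q) (hpq : p ≤ q) : S ⊆ T := by
  intro x hx
  by_contra hxT
  have hqx : q ≤ xᶜ := hq.2 fun y hy =>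
    le_compl_iff_disjoint_left.2 <| disjoint_iff.2 <|
      hdisj x (hSA hx) y (hTA hy) fun h => hxT (h ▸ hy)
  have hxx : x ≤ xᶜ := (hp.1 hx).trans (hpq.trans hqx)
  have hx0 : x = ⊥ := disjoint_self.1 (le_compl_iff_disjoint_left.1 hxx)
  exact hbot (hx0 ▸ hSA hx)

/-- If all suprema exist in a Boolean algebra, then it has at least as many elements as any of its
antichains has subsets. -/
theorem two_power_mk_antichain_le {α : Type*} [BooleanAlgebra α]
    (hcomplete : ∀ S : Set α, ∃ p : α, IsLUB S p) {A : Set α} (hbot : ⊥ ∉ A)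
    (hdisj : ∀ x ∈ A, ∀ y ∈ A, x ≠ y → x ⊓ y = ⊥) :
    2 ^ Cardinal.mk A ≤ Cardinal.mk α := by
  choose sup hsup using hcomplete
  rw [← Cardinal.mk_powerset]
  refine Cardinal.mk_le_of_injective (f := fun S : 𝒫 A => sup S) fun S T h => Subtype.ext ?_
  exact Set.Subset.antisymm
    (subset_of_isLUB_le_of_antichain hbot hdisj S.2 T.2 (hsup S) (hsup T) h.le)
    (subset_of_isLUB_le_of_antichain hbot hdisj T.2 S.2 (hsup T) (hsup S) h.ge)

/-- A 𝒞-complete class-sized Boolean algebra satisfies the Ord-chain condition: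
every antichain (a set of pairwise disjoint nonzero elements) is u-small. -/
theorem ord_cc_of_C_complete (α : Type (u + 1)) [BooleanAlgebra α]
    (e : α ≃ Ordinal.{u}) (hcomplete : ∀ S : Set α, ∃ p : α, IsLUB S p) :
    ∀ A : Set α, ⊥ ∉ A → (∀ x ∈ A, ∀ y ∈ A, x ≠ y → x ⊓ y = ⊥) → Small.{u} A := by
  intro A hbot hdisj
  have hlt : Cardinal.mk A < Cardinal.mk Ordinal.{u} :=
    (Cardinal.cantor _).trans_le <|
      (two_power_mk_antichain_le hcomplete hbot hdisj).trans_eq (Cardinal.mk_congr e)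
  rw [Cardinal.small_iff_lift_mk_lt_univ, Cardinal.lift_id]
  rwa [Cardinal.mk_ordinal] at hlt
end

section
/- Let α be a Boolean algebra and let A, D, E be three pairwise disjoint subsets of α with ⊥ ∉ A ∪ D ∪ E, such that any two distinct elements x, y of A ∪ D ∪ E satisfy x ⊓ y = ⊥ (A ∪ D ∪ E is an antichain). If p is a least upper bound of A ∪ D and q is a least upper bound of A ∪ E, then p ⊓ q is a least upper bound of A. (This is the first Claim in the proof of Theorem 6.6 of the paper, stated contrapositively there: if sup A does not exist, then at least one of sup(A ∪ D) and sup(A ∪ E) does not exist.) -/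
/-- If `A ∪ D ∪ E` is an antichain in a Boolean algebra with `A`, `D`, `E` pairwise
disjoint, and `p`, `q` are least upper bounds of `A ∪ D` and `A ∪ E` respectively,
then `p ⊓ q` is a least upper bound of `A`. -/
theorem isLUB_inf_of_isLUB_union {α : Type*} [BooleanAlgebra α]
    (A D E : Set α) (hAD : Disjoint A D) (hAE : Disjoint A E) (hDE : Disjoint D E)
    (hbot : ⊥ ∉ A ∪ D ∪ E)
    (hanti : ∀ x ∈ A ∪ D ∪ E, ∀ y ∈ A ∪ D ∪ E, x ≠ y → x ⊓ y = ⊥)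
    (p q : α) (hp : IsLUB (A ∪ D) p) (hq : IsLUB (A ∪ E) q) :
    IsLUB A (p ⊓ q) := by
  refine ⟨fun a ha => le_inf (hp.1 (Or.inl ha)) (hq.1 (Or.inl ha)), fun u hu => ?_⟩
  have hqD : ∀ d ∈ D, q ≤ dᶜ := by
    refine fun d hd => hq.2 ?_
    rintro x (hx | hx)
    · exact le_compl_iff_disjoint_right.2 (disjoint_iff.2
        (hanti x (Or.inl (Or.inl hx)) d (Or.inl (Or.inr hd)) (hAD.ne_of_mem hx hd)))
    · exact le_compl_iff_disjoint_right.2 (disjoint_iff.2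
        (hanti x (Or.inr hx) d (Or.inl (Or.inr hd)) (hDE.ne_of_mem hd hx).symm))
  have hpq : p ≤ qᶜ ⊔ u := by
    refine hp.2 ?_
    rintro x (hx | hx)
    · exact (hu hx).trans le_sup_right
    · exact (le_compl_comm.1 (hqD x hx)).trans le_sup_left
  calc p ⊓ q ≤ (qᶜ ⊔ u) ⊓ q := inf_le_inf_right q hpq
    _ = u ⊓ q := by rw [inf_sup_right, compl_inf_self, bot_sup_eq]
    _ ≤ u := inf_le_left
end

section
/- Let P be a partial order, let A ⊆ P be an antichain, let X, X′ ⊆ A, and let B ⊆ P. If sup X = sup B in the generalized sense and sup X′ = sup B in the generalized sense, then X = X′. (This is the injectivity claim in the proof of Lemma 4.4 of the paper: distinct subclasses of an antichain cannot have the same generalized supremum as one and the same set B.) -/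
/-- Among subsets of an antichain, a subset with the same generalized supremum as `B` is
contained in every other such subset. -/
theorem IsAntichain'.subset_of_supEq_s5 {P : Type*} [PartialOrder P] {A X X' B : Set P}
    (hA : IsAntichain' A) (hX : X ⊆ A) (hX' : X' ⊆ A) (h1 : SupEq X B) (h2 : SupEq X' B) :
    X ⊆ X' := by
  intro x hx
  obtain ⟨b, hb, r, hrx, hrb⟩ := h1.2 x hx x le_rfl
  obtain ⟨y, hy, s, hsr, hsy⟩ := h2.1 b hb r hrb
  have hxy : x = y := by
    by_contra hne
    exact hA x (hX hx) y (hX' hy) hne ⟨s, hsr.trans hrx, hsy⟩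
  rwa [hxy]

/-- Distinct subsets of an antichain cannot have the same generalized supremum as
one and the same set `B`. -/
theorem subsets_of_antichain_supEq_injective {P : Type*} [PartialOrder P]
    (A : Set P) (hA : IsAntichain' A) (X X' B : Set P)
    (hX : X ⊆ A) (hX' : X' ⊆ A) (h1 : SupEq X B) (h2 : SupEq X' B) :
    X = X' :=
  (hA.subset_of_supEq_s5 hX hX' h1 h2).antisymm (hA.subset_of_supEq_s5 hX' hX h2 h1)
end

section
/- Let C : Ordinal.{u} → Set Ordinal.{u} be an Ord-indexed sequence of classes of ordinals such that each C i is unbounded (with respect to <) and every class occurring in the sequence occurs unboundedly often, i.e. for every i the class {j | C j = C i} is unbounded. Then there exists a sequence D : Ordinal.{u} → Set Ordinal.{u} of pairwise disjoint classes of ordinals whose union is the class of all ordinals (⋃ β, D β = Set.univ), such that C α ∩ D β is unbounded for all ordinals α and β. (This is the Claim in the proof of Lemma 2.5 of the paper: given an Ord-enumeration of proper classes of ordinals in which each class appears unboundedly often, there is a partition ⟨D_β⟩ of Ord such that C_α ∩ D_β is a proper class for all α, β.) -/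
universe u

theorem Ordinal.unbounded_range_of_injective {g : Ordinal.{u} → Ordinal.{u}}
    (hg : Function.Injective g) : Set.Unbounded (· < ·) (Set.range g) := by
  intro a
  by_contra! h
  have : Small.{u} (Set.range g) := small_subset (s := Set.Iio a) h
  exact not_small_ordinal.{u, u} ((small_congr (Equiv.ofInjective g hg)).2 this)

theorem Ordinal.exists_strictMono_forall_mem {A : Ordinal.{u} → Set Ordinal.{u}}
    (hA : ∀ i, Set.Unbounded (· < ·) (A i)) :
    ∃ f : Ordinal.{u} → Ordinal.{u}, StrictMono f ∧ ∀ i, f i ∈ A i := by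
  have step (i : Ordinal.{u}) (g : (j : Ordinal.{u}) → j < i → Ordinal.{u}) :
      ∃ b ∈ A i, ∀ j (hj : j < i), g j hj < b := by
    obtain ⟨a, ha⟩ := Ordinal.bddAbove_of_small
      (s := Set.range fun j : Set.Iio i => g j.1 j.2)
    obtain ⟨b, hb, hab⟩ := hA i (Order.succ a)
    exact ⟨b, hb, fun j hj =>
      (ha ⟨⟨j, hj⟩, rfl⟩).trans_lt (Order.succ_le_iff.1 (not_lt.1 hab))⟩
  choose F hF hlt using step
  let f : Ordinal.{u} → Ordinal.{u} := Ordinal.lt_wf.fix F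
  have hf (i) : f i = F i fun j _ => f j := Ordinal.lt_wf.fix_eq F i
  refine ⟨f, fun j i hij => ?_, fun i => ?_⟩
  · rw [hf i]
    exact hlt i (fun j _ => f j) j hij
  · rw [hf i]
    exact hF i _

theorem Ordinal.nonempty_equiv_prod : Nonempty (Ordinal.{u} ≃ Ordinal.{u} × Ordinal.{u}) := by
  rw [← Cardinal.eq, Cardinal.mk_prod, Cardinal.lift_id,
    Cardinal.mul_eq_self (Cardinal.aleph0_le_mk _)]

/-- Given an Ord-enumeration of proper classes of ordinals in which each class appears
unboundedly often, there is a partition `⟨D β⟩` of Ord such that `C α ∩ D β` is a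
proper class for all `α`, `β`. -/
theorem exists_partition_unbounded_inter
    (C : Ordinal.{u} → Set Ordinal.{u})
    (hC : ∀ i, Set.Unbounded (· < ·) (C i))
    (hrep : ∀ i, Set.Unbounded (· < ·) {j | C j = C i}) :
    ∃ D : Ordinal.{u} → Set Ordinal.{u},
      (∀ β γ, β ≠ γ → Disjoint (D β) (D γ)) ∧
      (⋃ β, D β) = Set.univ ∧
      ∀ α β, Set.Unbounded (· < ·) (C α ∩ D β) := by
  obtain ⟨p⟩ := Ordinal.nonempty_equiv_prod.{u}
  let e : Ordinal.{u} ≃ Ordinal.{u} × Ordinal.{u} × Ordinal.{u} :=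
    p.trans ((Equiv.refl _).prodCongr p)
  obtain ⟨f, hf, hfC⟩ := Ordinal.exists_strictMono_forall_mem fun i => hC (e i).1
  let c : Ordinal.{u} → Ordinal.{u} := Function.extend f (fun i => (e i).2.1) fun _ => 0
  refine ⟨fun β => c ⁻¹' {β}, fun β γ h => ?_, ?_, fun α β => ?_⟩
  · exact (Set.disjoint_singleton.2 h).preimage c
  · ext x
    simp
  · have hinj : Function.Injective fun γ => f (e.symm (α, β, γ)) := fun γ δ h => by
      simpa using hf.injective h
    refine Set.Unbounded.mono ?_ (Ordinal.unbounded_range_of_injective hinj)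
    rintro _ ⟨γ, rfl⟩
    refine ⟨by simpa using hfC (e.symm (α, β, γ)), ?_⟩
    simp [c, hf.injective.extend_apply]
end

section
/- Let C : Ordinal.{u} → Set Ordinal.{u} be an Ord-indexed sequence of classes of ordinals such that each C γ is unbounded (with respect to <) and every class occurring in the sequence occurs unboundedly often, i.e. for every γ the class {j | C j = C γ} is unbounded. Then there exists a class D : Set Ordinal.{u} such that for every γ, both C γ ∩ D and C γ \ D are unbounded. (This is the Claim in the proof of Lemma 3.2 of the paper: there is a class D such that both C_γ ∩ D and C_γ \ D are proper classes for all γ ∈ Ord.) -/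
universe u

/-- Given a sequence of classes of ordinals, recursively choose the least member of the `j`-th
class above all members chosen before. -/
noncomputable def increasingSelector (C : Ordinal.{u} → Set Ordinal.{u}) (j : Ordinal.{u}) :
    Ordinal.{u} :=
  sInf {b | b ∈ C j ∧ ∀ i, ∀ _ : i < j, increasingSelector C i < b}
termination_by j

theorem increasingSelector_spec {C : Ordinal.{u} → Set Ordinal.{u}}
    (hC : ∀ γ, Set.Unbounded (· < ·) (C γ)) (j : Ordinal.{u}) :
    increasingSelector C j ∈ C j ∧
      ∀ i < j, increasingSelector C i < increasingSelector C j := by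
  have hne : {b | b ∈ C j ∧ ∀ i, ∀ _ : i < j, increasingSelector C i < b}.Nonempty := by
    obtain ⟨a, ha⟩ := Ordinal.bddAbove_of_small (s := increasingSelector C '' Set.Iio j)
    obtain ⟨b, hb, hab⟩ := hC j (Order.succ a)
    refine ⟨b, hb, fun i hi => ?_⟩
    exact (Order.lt_succ_of_le (ha ⟨i, hi, rfl⟩)).trans_le (not_lt.mp hab)
  have hmem := csInf_mem hne
  rwa [← increasingSelector] at hmem

theorem strictMono_increasingSelector {C : Ordinal.{u} → Set Ordinal.{u}}
    (hC : ∀ γ, Set.Unbounded (· < ·) (C γ)) : StrictMono (increasingSelector C) :=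
  fun i j hij => (increasingSelector_spec hC j).2 i hij

/-- Given an Ord-enumeration of proper classes of ordinals in which each class appears
unboundedly often, there is a class `D` such that both `C γ ∩ D` and `C γ \ D` are
proper classes for all `γ`. -/
theorem exists_class_unbounded_inter_and_diff
    (C : Ordinal.{u} → Set Ordinal.{u})
    (hC : ∀ γ, Set.Unbounded (· < ·) (C γ))
    (hrep : ∀ γ, Set.Unbounded (· < ·) {j | C j = C γ}) :
    ∃ D : Set Ordinal.{u},
      ∀ γ, Set.Unbounded (· < ·) (C γ ∩ D) ∧ Set.Unbounded (· < ·) (C γ \ D) := by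
  have hC' : ∀ γ, Set.Unbounded (· < ·) (C (γ / 2)) := fun γ => hC _
  set f := increasingSelector fun j => C (j / 2)
  have hf : StrictMono f := strictMono_increasingSelector hC'
  have hmem : ∀ j, f j ∈ C (j / 2) := fun j => (increasingSelector_spec hC' j).1
  have h2 : (2 : Ordinal.{u}) ≠ 0 := two_ne_zero
  have hle : ∀ j : Ordinal.{u}, j ≤ 2 * j := fun j =>
    Ordinal.le_mul_right j (pos_iff_ne_zero.mpr h2)
  have hdiv : ∀ j : Ordinal.{u}, (2 * j + 1) / 2 = j := fun j => by
    rw [Ordinal.mul_add_div _ h2, Ordinal.div_eq_zero_of_lt one_lt_two, add_zero]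
  refine ⟨Set.range fun k => f (2 * k), fun γ => ⟨fun a => ?_, fun a => ?_⟩⟩
  · obtain ⟨j, hj, haj⟩ := hrep γ a
    refine ⟨f (2 * j), ⟨?_, j, rfl⟩, ?_⟩
    · simpa [Ordinal.mul_div_cancel j h2, show C j = C γ from hj] using hmem (2 * j)
    · exact not_lt.mpr ((not_lt.mp haj).trans ((hle j).trans hf.le_apply))
  · obtain ⟨j, hj, haj⟩ := hrep γ a
    refine ⟨f (2 * j + 1), ⟨?_, ?_⟩, ?_⟩
    · simpa only [hdiv, show C j = C γ from hj] using hmem (2 * j + 1)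
    · rintro ⟨k, hk⟩
      have hkj : 2 * k = 2 * j + 1 := hf.injective hk
      have hk' : k = j := by rw [← hdiv j, ← hkj, Ordinal.mul_div_cancel k h2]
      rw [hk'] at hkj
      exact (lt_add_one (2 * j)).ne hkj
    · exact not_lt.mpr ((not_lt.mp haj).trans
        ((hle j).trans (le_self_add.trans hf.le_apply)))
end
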